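/- Let N be a weakly norming bipartite graph and H an N-decomposable graph, i.e., H admits a tree decomposition (F, T) in which every bag induces a copy of N and adjacent bags overlap compatibly. Then for every graphon (symmetric bounded measurable W : [0,1]² → [0,1]), t_H(W) ≥ t_N(W)^{|E(H)|/|E(N)|}. In particular, since N has Sidorenko's property, H satisfies Sidorenko's conjecture: t_H(W) ≥ t_{K_2}(W)^{|E(H)|}. -/

import Mathlib

open MeasureTheory

/-- The unit box `[0,1]^n`. -/
noncomputable def unitBox (n : ℕ) : Set (Fin n → ℝ) :=
  Set.univ.pi fun _ => Set.Icc (0 : ℝ) 1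

/-- The edges of `H`, each listed once as an ordered pair `(i, j)` with `i < j`. -/
def edgePairs {n : ℕ} (H : SimpleGraph (Fin n)) [DecidableRel H.Adj] :
    Finset (Fin n × Fin n) :=
  Finset.univ.filter fun p => H.Adj p.1 p.2 ∧ p.1 < p.2

/-- `∫ ∏_{ij ∈ E(H)} |f(x_i, x_j)| dμ^{|V(H)|}` over the unit box. -/
noncomputable def tAbs {n : ℕ} (H : SimpleGraph (Fin n)) [DecidableRel H.Adj]
    (f : ℝ → ℝ → ℝ) : ℝ :=
  ∫ x in unitBox n, ∏ p ∈ edgePairs H, |f (x p.1) (x p.2)|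

/-- The functional `‖f‖_{r(H)} = tAbs(H, f)^{1/|E(H)|}`. -/
noncomputable def rNorm {n : ℕ} (H : SimpleGraph (Fin n)) [DecidableRel H.Adj]
    (f : ℝ → ℝ → ℝ) : ℝ :=
  tAbs H f ^ (((edgePairs H).card : ℝ)⁻¹)

/-- `f` is bounded. -/
def BddFun (f : ℝ → ℝ → ℝ) : Prop := ∃ C : ℝ, ∀ x y, |f x y| ≤ C

/-- `H` is weakly norming: `‖·‖_{r(H)}` is a norm on bounded measurable functions on `[0,1]²`
(it satisfies the triangle inequality and vanishes only at the a.e. zero function; homogeneity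
is automatic). -/
def WeaklyNorming {n : ℕ} (H : SimpleGraph (Fin n)) [DecidableRel H.Adj] : Prop :=
  (∀ f g : ℝ → ℝ → ℝ, Measurable (Function.uncurry f) → Measurable (Function.uncurry g) →
    BddFun f → BddFun g →
      rNorm H (fun x y => f x y + g x y) ≤ rNorm H f + rNorm H g) ∧
  (∀ f : ℝ → ℝ → ℝ, Measurable (Function.uncurry f) → BddFun f → rNorm H f = 0 →
      ∀ᵐ z : ℝ × ℝ ∂(volume.restrict (Set.Icc (0 : ℝ) 1 ×ˢ Set.Icc (0 : ℝ) 1)),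
        f z.1 z.2 = 0)


/-- The homomorphism density `t_H(f) = ∫ ∏_{ij∈E(H)} f(x_i,x_j)` over `[0,1]^{V(H)}`. -/
noncomputable def tDen {n : ℕ} (H : SimpleGraph (Fin n)) [DecidableRel H.Adj]
    (f : ℝ → ℝ → ℝ) : ℝ :=
  ∫ x in unitBox n, ∏ p ∈ edgePairs H, f (x p.1) (x p.2)


open scoped ENNReal

namespace NDec

/-- Uniform measure on `[0,1]`. -/
noncomputable def um : Measure ℝ := volume.restrict (Set.Icc (0 : ℝ) 1)

instance : IsProbabilityMeasure um := ⟨by simp [um]⟩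

lemma restrict_box (n : ℕ) :
    (volume : Measure (Fin n → ℝ)).restrict (unitBox n) = Measure.pi (fun _ => um) := by
  rw [unitBox, volume_pi, Measure.restrict_pi_pi]; rfl

/-- Marginal with respect to the uniform measure. -/
noncomputable def lm {n : ℕ} (s : Finset (Fin n)) (f : (Fin n → ℝ) → ℝ≥0∞) :
    (Fin n → ℝ) → ℝ≥0∞ := lmarginal (fun _ => um) s f

lemma lm_meas {n : ℕ} (s : Finset (Fin n)) {f : (Fin n → ℝ) → ℝ≥0∞} (hf : Measurable f) :
    Measurable (lm s f) := hf.lmarginal _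

lemma lm_dep {n : ℕ} (s t : Finset (Fin n)) (f : (Fin n → ℝ) → ℝ≥0∞) (h : sᶜ ⊆ t) :
    DependsOn (lm s f) (t : Set (Fin n)) := by
  intro x y hxy
  exact lmarginal_congr _ _ fun i hi => hxy i (Finset.mem_coe.2 (h (Finset.mem_compl.2 hi)))

lemma lm_pull {n : ℕ} (s t : Finset (Fin n)) (f h : (Fin n → ℝ) → ℝ≥0∞) (hf : Measurable f)
    (hd : DependsOn h (t : Set (Fin n))) (hst : Disjoint s t) :
    lm s (fun x => f x * h x) = fun x => lm s f x * h x := by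
  funext x
  unfold lm lmarginal
  rw [← lintegral_mul_const]
  · refine lintegral_congr fun y => ?_
    dsimp only
    congr 1
    apply hd
    intro i hi
    have : i ∉ s := fun h => Finset.disjoint_left.1 hst h (Finset.mem_coe.1 hi)
    simp [Function.updateFinset, this]
  · exact hf.comp measurable_updateFinset

lemma lm_id {n : ℕ} (s t : Finset (Fin n)) (h : (Fin n → ℝ) → ℝ≥0∞)
    (hd : DependsOn h (t : Set (Fin n))) (hst : Disjoint s t) : lm s h = h := by
  have := lm_pull s t (fun _ => 1) h measurable_const hd hst
  simp only [one_mul] at this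
  rw [this]; funext x
  simp [lm, lmarginal]

lemma lm_nest {n : ℕ} (s t : Finset (Fin n)) (h : (Fin n → ℝ) → ℝ≥0∞) (hm : Measurable h)
    (hst : s ⊆ t) : lm t h = lm (t \ s) (lm s h) := by
  unfold lm
  rw [← lmarginal_union _ _ hm Finset.sdiff_disjoint, Finset.sdiff_union_of_subset hst]

lemma lm_eq_of_dep {n : ℕ} (s t A : Finset (Fin n)) (h : (Fin n → ℝ) → ℝ≥0∞) (hm : Measurable h)
    (hd : DependsOn h (A : Set (Fin n))) (hst : s ∩ A = t ∩ A) : lm s h = lm t h := by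
  have key : ∀ s : Finset (Fin n), lm s h = lm (s ∩ A) h := by
    intro s
    rw [lm_nest (s \ A) s h hm Finset.sdiff_subset, lm_id (s \ A) A h hd Finset.sdiff_disjoint]
    congr 1; ext; simp
  rw [key s, key t, hst]

lemma lm_univ {n : ℕ} (h : (Fin n → ℝ) → ℝ≥0∞) (x : Fin n → ℝ) :
    lm Finset.univ h x = ∫⁻ y, h y ∂Measure.pi (fun _ => um) := by
  simp [lm]

lemma lint_lm {n : ℕ} (s : Finset (Fin n)) (h : (Fin n → ℝ) → ℝ≥0∞) (hm : Measurable h) :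
    ∫⁻ y, lm s h y ∂Measure.pi (fun _ => um) = ∫⁻ y, h y ∂Measure.pi (fun _ => um) := by
  rw [← lm_univ h 0, lm_nest s _ h hm (Finset.subset_univ _), ← lm_univ _ 0]
  refine congrFun ?_ _
  exact lm_eq_of_dep _ _ sᶜ _ (lm_meas s hm) (lm_dep _ _ _ subset_rfl) (by ext; simp)

lemma lint_comp_inj {n m : ℕ} (e : Fin m → Fin n) (he : Function.Injective e)
    (h : (Fin m → ℝ) → ℝ≥0∞) (hm : Measurable h) :
    ∫⁻ y, h (fun i => y (e i)) ∂Measure.pi (fun _ : Fin n => um)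
      = ∫⁻ y, h y ∂Measure.pi (fun _ => um) := by
  have h1 := lmarginal_image (μ := fun _ : Fin n => um) he Finset.univ hm 0
  rw [lmarginal_univ] at h1
  rw [← lm_univ _ 0]
  refine Eq.trans ?_ h1
  change _ = lm _ _ 0
  refine congrFun ?_ _
  apply lm_eq_of_dep _ _ (Finset.univ.image e)
  · exact hm.comp (by fun_prop)
  · intro x y hxy
    dsimp only
    congr 1; funext i
    exact hxy _ (by simp)
  · simp

/-- One gluing step. -/
lemma glue {n : ℕ} (U Fl K Fj : Finset (Fin n)) (f wl wj G : (Fin n → ℝ) → ℝ≥0∞)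
    (hfm : Measurable f) (hlm : Measurable wl) (hjm : Measurable wj)
    (hfd : DependsOn f (U : Set (Fin n))) (hld : DependsOn wl (Fl : Set (Fin n)))
    (h1 : Fl ∩ U ⊆ K) (h2 : K ⊆ Fl) (h3 : K ⊆ Fj) (h4 : Fj ⊆ U)
    (hmarg : lm Fjᶜ f = wj) (hGl : lm Kᶜ wl = G) (hGj : lm Kᶜ wj = G)
    (hG0 : ∀ x, G x ≠ 0) (hGt : ∀ x, G x ≠ ⊤) :
    (∀ h : (Fin n → ℝ) → ℝ≥0∞, Measurable h → DependsOn h (U : Set (Fin n)) →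
      lm Uᶜ (fun x => (f x * wl x / G x) * h x) = fun x => f x * h x) ∧
    lm Flᶜ (fun x => f x * wl x / G x) = wl := by
  have hGm : Measurable G := hGl ▸ lm_meas _ hlm
  have hGd : DependsOn G (K : Set (Fin n)) := hGl ▸ lm_dep _ _ _ (by simp)
  have hKU : K ⊆ U := h3.trans h4
  constructor
  · intro h hm hd
    have e1 : (fun x => (f x * wl x / G x) * h x) = fun x => wl x * (f x / G x * h x) := by
      funext x; simp only [div_eq_mul_inv]; ring
    rw [e1, lm_pull Uᶜ U _ _ hlm _ disjoint_compl_left]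
    · rw [lm_eq_of_dep Uᶜ Kᶜ Fl wl hlm hld, hGl]
      · funext x
        rw [← mul_assoc, ENNReal.mul_div_cancel (hG0 x) (hGt x)]
      · ext v
        have a := @h1 v
        have b := @hKU v
        simp only [Finset.mem_inter, Finset.mem_compl] at *
        tauto
    · intro x y hxy
      dsimp only
      rw [hfd hxy, hd hxy, hGd fun i hi => hxy i (hKU hi)]
  · have e1 : (fun x => f x * wl x / G x) = fun x => f x * (wl x / G x) := by
      funext x; simp only [div_eq_mul_inv]; ring
    rw [e1, lm_pull Flᶜ Fl _ _ hfm _ disjoint_compl_left]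
    · have : lm Flᶜ f = G := by
        rw [lm_eq_of_dep Flᶜ Kᶜ U f hfm hfd, lm_nest Fjᶜ Kᶜ f hfm, hmarg, ← hGj]
        · symm
          rw [lm_nest Fjᶜ Kᶜ _ hjm]
          · congr 1
            apply lm_id _ Fj _ _ disjoint_compl_left
            rw [← hmarg]; exact lm_dep _ _ _ (by simp)
          · exact Finset.compl_subset_compl.2 h3
        · exact Finset.compl_subset_compl.2 h3
        · ext v
          have a := @h1 v
          have b := @h2 v
          simp only [Finset.mem_inter, Finset.mem_compl] at *
          tauto
      rw [this]; funext x
      exact ENNReal.mul_div_cancel (hG0 x) (hGt x)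
    · intro x y hxy
      dsimp only
      rw [hld hxy, hGd fun i hi => hxy i (h2 hi)]


/-- Product of `f` over a set of pairs. -/
def wp {n : ℕ} (f : ℝ → ℝ → ℝ) (Q : Finset (Fin n × Fin n)) (x : Fin n → ℝ) : ℝ :=
  ∏ p ∈ Q, f (x p.1) (x p.2)

/-- Good kernels: measurable, bounded below by a positive constant, at most one. -/
structure Good (f : ℝ → ℝ → ℝ) : Prop where
  meas : Measurable (Function.uncurry f)
  low : ∃ ε > 0, ∀ x y, ε ≤ f x y
  high : ∀ x y, f x y ≤ 1

lemma Good.pos {f : ℝ → ℝ → ℝ} (hf : Good f) (x y : ℝ) : 0 < f x y := by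
  obtain ⟨ε, h0, h⟩ := hf.low
  exact h0.trans_le (h x y)

lemma wp_meas' {n : ℕ} {f : ℝ → ℝ → ℝ} (hf : Measurable (Function.uncurry f))
    (Q : Finset (Fin n × Fin n)) : Measurable (wp f Q) := by
  unfold wp
  refine Finset.measurable_fun_prod _ fun p _ => ?_
  have h : Measurable fun x : Fin n → ℝ => (x p.1, x p.2) := by fun_prop
  exact hf.comp h

lemma wp_pos {n : ℕ} {f : ℝ → ℝ → ℝ} (hf : Good f) (Q : Finset (Fin n × Fin n)) (x) :
    0 < wp f Q x := Finset.prod_pos fun _ _ => hf.pos _ _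

lemma wp_le {n : ℕ} {f : ℝ → ℝ → ℝ} (hf : Good f) (Q : Finset (Fin n × Fin n)) (x) :
    wp f Q x ≤ 1 := Finset.prod_le_one (fun _ _ => (hf.pos _ _).le) fun _ _ => hf.high _ _

/-- Density. -/
noncomputable def td {n : ℕ} (f : ℝ → ℝ → ℝ) (Q : Finset (Fin n × Fin n)) : ℝ :=
  ∫ x, wp f Q x ∂Measure.pi (fun _ => um)

lemma tDen_eq {n : ℕ} (H : SimpleGraph (Fin n)) [DecidableRel H.Adj] (f : ℝ → ℝ → ℝ) :
    tDen H f = td f (edgePairs H) := by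
  unfold tDen td; rw [restrict_box]; rfl

lemma tAbs_eq {n : ℕ} (H : SimpleGraph (Fin n)) [DecidableRel H.Adj] (f : ℝ → ℝ → ℝ)
    (hf : ∀ x y, 0 ≤ f x y) :
    tAbs H f = td f (edgePairs H) := by
  unfold tAbs td; rw [restrict_box]
  simp only [wp, abs_of_nonneg (hf _ _)]

lemma wp_int {n : ℕ} {f : ℝ → ℝ → ℝ} (hf : Measurable (Function.uncurry f))
    (C : ℝ) (h0 : ∀ x y, 0 ≤ f x y) (hC : ∀ x y, f x y ≤ C)
    (Q : Finset (Fin n × Fin n)) : Integrable (wp f Q) (Measure.pi (fun _ => um)) := by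
  refine Integrable.of_bound (wp_meas' hf Q).aestronglyMeasurable (C ^ Q.card)
    (Filter.Eventually.of_forall fun x => ?_)
  have : 0 ≤ wp f Q x := Finset.prod_nonneg fun _ _ => h0 _ _
  rw [Real.norm_of_nonneg this]
  rw [← Finset.prod_const]
  exact Finset.prod_le_prod (fun _ _ => h0 _ _) (fun _ _ => hC _ _)

lemma td_pos {n : ℕ} {f : ℝ → ℝ → ℝ} (hf : Good f) (Q : Finset (Fin n × Fin n)) :
    0 < td f Q := by
  obtain ⟨ε, h0, h⟩ := hf.low
  have h1 : ε ^ Q.card ≤ td f Q := by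
    have := integral_mono (μ := Measure.pi (fun _ : Fin n => um)) (integrable_const (ε ^ Q.card))
      (wp_int hf.meas 1 (fun _ _ => (hf.pos _ _).le) hf.high Q)
      (fun x => by
        simp only [wp, ← Finset.prod_const]
        exact Finset.prod_le_prod (fun _ _ => h0.le) (fun _ _ => h _ _))
    rw [integral_const] at this
    simpa [td] using this
  exact (pow_pos h0 _).trans_le h1

lemma exists_square : ∃ φ : ℝ → ℝ × ℝ, MeasurePreserving φ um (um.prod um) := by
  obtain ⟨f, hf, hm⟩ := Measure.exists_measurable_map_eq (um.prod um)
  have hI : MeasurePreserving (fun x : unitInterval => (x : ℝ)) volume um := by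
    exact measurePreserving_subtype_coe measurableSet_Icc
  refine ⟨fun x => f (Set.projIcc 0 1 zero_le_one x), ?_, ?_⟩
  · exact hf.comp continuous_projIcc.measurable
  · rw [← hm]
    conv_lhs => rw [← hI.map_eq]
    rw [Measure.map_map _ hI.measurable]
    · congr 1
      funext x; simp
    · exact hf.comp continuous_projIcc.measurable

/-- Tensor square of a kernel. -/
def sq (φ : ℝ → ℝ × ℝ) (f : ℝ → ℝ → ℝ) : ℝ → ℝ → ℝ :=
  fun x y => f (φ x).1 (φ y).1 * f (φ x).2 (φ y).2

lemma sq_good {φ : ℝ → ℝ × ℝ} (hφ : Measurable φ) {f : ℝ → ℝ → ℝ} (hf : Good f) :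
    Good (sq φ f) := by
  refine ⟨?_, ?_, ?_⟩
  · have h1 : Measurable fun z : ℝ × ℝ => ((φ z.1).1, (φ z.2).1) := by fun_prop
    have h2 : Measurable fun z : ℝ × ℝ => ((φ z.1).2, (φ z.2).2) := by fun_prop
    exact (hf.meas.comp h1).mul (hf.meas.comp h2)
  · obtain ⟨ε, h0, h⟩ := hf.low
    exact ⟨ε * ε, by positivity, fun x y => mul_le_mul (h _ _) (h _ _) h0.le (hf.pos _ _).le⟩
  · intro x y
    exact mul_le_one₀ (hf.high _ _) (hf.pos _ _).le (hf.high _ _)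

lemma td_sq {n : ℕ} {φ : ℝ → ℝ × ℝ} (hφ : MeasurePreserving φ um (um.prod um)) {f : ℝ → ℝ → ℝ}
    (hf : Good f) (Q : Finset (Fin n × Fin n)) : td (sq φ f) Q = td f Q ^ 2 := by
  have h1 : MeasurePreserving (fun (x : Fin n → ℝ) i => φ (x i)) (Measure.pi fun _ => um)
      (Measure.pi fun _ => um.prod um) :=
    measurePreserving_pi (fun _ => um) (fun _ => um.prod um) (fun _ => hφ)
  have h2 := measurePreserving_arrowProdEquivProdArrow ℝ ℝ (Fin n) (fun _ => um) (fun _ => um)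
  have h3 := h2.comp h1
  have hm := wp_meas' hf.meas Q
  have h4 := integral_map (μ := Measure.pi fun _ : Fin n => um) h3.measurable.aemeasurable
    (f := fun z : (Fin n → ℝ) × (Fin n → ℝ) => wp f Q z.1 * wp f Q z.2)
    (by
      apply Measurable.aestronglyMeasurable
      exact (hm.comp measurable_fst).mul (hm.comp measurable_snd))
  rw [h3.map_eq, integral_prod_mul] at h4
  rw [pow_two]
  unfold td
  rw [h4]
  refine integral_congr_ae (Filter.Eventually.of_forall fun x => ?_)
  simp only [wp, sq, Finset.prod_mul_distrib]
  rfl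

lemma pow_trick {a b C : ℝ} (ha : 0 < a) (h : ∀ k : ℕ, b ^ (2 ^ k) ≤ C * a ^ (2 ^ k)) :
    b ≤ a := by
  by_contra hlt
  push Not at hlt
  have h1 : 1 < b / a := (one_lt_div ha).2 hlt
  obtain ⟨m, hm⟩ := pow_unbounded_of_one_lt C h1
  have h2 : (b / a) ^ m ≤ (b / a) ^ (2 ^ m) := pow_le_pow_right₀ h1.le Nat.lt_two_pow_self.le
  have h3 : (b / a) ^ (2 ^ m) ≤ C := by
    rw [div_pow, div_le_iff₀ (by positivity)]; exact h m
  linarith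

lemma dom_weak {n : ℕ} (N : SimpleGraph (Fin n)) [DecidableRel N.Adj]
    (hWN : WeaklyNorming N) (hNE : (edgePairs N).Nonempty) {f : ℝ → ℝ → ℝ} (hf : Good f)
    (J : Finset (Fin n × Fin n)) (hJ : J ⊆ edgePairs N) :
    td f J ≤ 2 ^ (edgePairs N).card *
      (td f (edgePairs N) ^ (((edgePairs N).card : ℝ)⁻¹)) ^ J.card := by
  set E := edgePairs N with hE
  set a := td f E ^ ((E.card : ℝ)⁻¹) with ha
  have hEc : E.card ≠ 0 := Finset.card_ne_zero.2 hNE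
  have hτ : 0 < td f E := td_pos hf E
  have ha0 : 0 < a := Real.rpow_pos_of_pos hτ _
  have haE : a ^ E.card = td f E := Real.rpow_inv_natCast_pow hτ.le hEc
  obtain ⟨ε, hε0, hε⟩ := hf.low
  have hp := hf.pos
  have hm1 : Measurable (Function.uncurry fun x y => f x y / a) := hf.meas.div_const a
  have hm2 : Measurable (Function.uncurry fun x y => f x y / a + 1) := hm1.add_const 1
  have hb1 : ∀ x y, f x y / a ≤ 1 / a := fun x y => div_le_div_of_nonneg_right (hf.high _ _) ha0.le
  have hp1 : ∀ x y, 0 ≤ f x y / a := fun x y => div_nonneg (hp x y).le ha0.le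
  have tri := hWN.1 (fun x y => f x y / a) (fun _ _ => 1) hm1 measurable_const
    ⟨1 / a, fun x y => by rw [abs_of_nonneg (hp1 x y)]; exact hb1 x y⟩ ⟨1, fun _ _ => by simp⟩
  have tdiv : ∀ Q : Finset (Fin n × Fin n), td (fun x y => f x y / a) Q = td f Q / a ^ Q.card := by
    intro Q
    unfold td
    rw [← integral_div]
    refine integral_congr_ae (Filter.Eventually.of_forall fun x => ?_)
    simp [wp, Finset.prod_div_distrib]
  have r1 : rNorm N (fun x y => f x y / a) = 1 := by
    unfold rNorm
    rw [tAbs_eq _ _ hp1, ← hE, tdiv, haE, div_self hτ.ne', Real.one_rpow]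
  have r2 : rNorm N (fun _ _ => (1 : ℝ)) = 1 := by
    unfold rNorm
    rw [tAbs_eq _ _ (fun _ _ => zero_le_one)]
    simp [td, wp]
  rw [r1, r2] at tri
  have hp2 : ∀ x y, 0 ≤ f x y / a + 1 := fun x y => by linarith [hp1 x y]
  have h2 : td (fun x y => f x y / a + 1) E ≤ 2 ^ E.card := by
    unfold rNorm at tri
    rw [tAbs_eq _ _ hp2, ← hE] at tri
    have h0 : 0 ≤ td (fun x y => f x y / a + 1) E :=
      integral_nonneg fun x => Finset.prod_nonneg fun _ _ => hp2 _ _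
    have := pow_le_pow_left₀ (Real.rpow_nonneg h0 _) tri E.card
    rw [Real.rpow_inv_natCast_pow h0 hEc] at this
    norm_num at this
    exact this
  have h3 : td (fun x y => f x y / a) J ≤ td (fun x y => f x y / a + 1) E := by
    refine integral_mono (wp_int hm1 (1 / a) hp1 hb1 J)
      (wp_int hm2 (1 / a + 1) hp2 (fun x y => by linarith [hb1 x y]) E) fun x => ?_
    calc wp (fun x y => f x y / a) J x ≤ wp (fun x y => f x y / a + 1) J x :=
          Finset.prod_le_prod (fun _ _ => hp1 _ _) (fun _ _ => by linarith)
      _ ≤ _ := Finset.prod_le_prod_of_subset_of_one_le hJ (fun _ _ => hp2 _ _)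
        (fun p _ _ => le_add_of_nonneg_left (hp1 _ _))
  rw [tdiv] at h3
  have := h3.trans h2
  rwa [div_le_iff₀ (by positivity)] at this

lemma dom {n : ℕ} (N : SimpleGraph (Fin n)) [DecidableRel N.Adj]
    (hWN : WeaklyNorming N) (hNE : (edgePairs N).Nonempty) {f : ℝ → ℝ → ℝ} (hf : Good f)
    (J : Finset (Fin n × Fin n)) (hJ : J ⊆ edgePairs N) :
    td f J ≤ td f (edgePairs N) ^ ((J.card : ℝ) / ((edgePairs N).card : ℝ)) := by
  obtain ⟨φ, hφ⟩ := exists_square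
  have hτ : 0 < td f (edgePairs N) := td_pos hf _
  have e1 : ∀ t : ℝ, 0 < t → t ^ ((J.card : ℝ) / ((edgePairs N).card : ℝ)) =
      (t ^ (((edgePairs N).card : ℝ)⁻¹)) ^ J.card := by
    intro t ht
    rw [← Real.rpow_natCast, ← Real.rpow_mul ht.le]; congr 1; ring
  rw [e1 _ hτ]
  refine pow_trick (C := 2 ^ (edgePairs N).card) (by positivity) fun k => ?_
  have : ∀ k : ℕ, ∃ g, Good g ∧ ∀ Q : Finset (Fin n × Fin n), td g Q = td f Q ^ (2 ^ k) := by
    intro k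
    induction k with
    | zero => exact ⟨f, hf, fun Q => by simp⟩
    | succ k ih =>
      obtain ⟨g, hg, h⟩ := ih
      refine ⟨sq φ g, sq_good hφ.measurable hg, fun Q => ?_⟩
      rw [td_sq hφ hg, h, ← pow_mul, pow_succ]
  obtain ⟨g, hg, h⟩ := this k
  have := dom_weak N hWN hNE hg J hJ
  rw [h, h] at this
  convert this using 2
  rw [← pow_mul, mul_comm, pow_mul]
  congr 1
  rw [← Real.rpow_natCast, ← Real.rpow_mul hτ.le, ← Real.rpow_natCast, ← Real.rpow_mul hτ.le,
    mul_comm]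


lemma tree_ind {ι : Type*} [Fintype ι] [DecidableEq ι] {nV : ℕ}
    (T : SimpleGraph ι) (hT : T.IsTree) (F : ι → Finset (Fin nV))
    (hpath : ∀ (i j kk : ι) (p : T.Walk i j), p.IsPath → kk ∈ p.support →
      F i ∩ F j ⊆ F kk) (P : Finset ι → Prop) (base : ∀ r, P {r})
    (step : ∀ S l j, l ∉ S → j ∈ S → T.Adj j l → (∀ i ∈ S, F i ∩ F l ⊆ F j) → P S →
      P (insert l S)) : P Finset.univ := by
  have key : ∀ (m : ℕ) (S : Finset ι), S.card = m → (T.induce (S : Set ι)).Connected → P S := by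
    intro m
    induction m with
    | zero =>
      intro S hS hc
      obtain ⟨x⟩ := hc.nonempty
      rw [Finset.card_eq_zero] at hS
      subst hS
      exact absurd x.2 (by simp)
    | succ m ih =>
      intro S hS hc
      rcases Nat.eq_zero_or_pos m with h0 | h0
      · subst h0
        obtain ⟨r, rfl⟩ := Finset.card_eq_one.1 hS
        exact base r
      · have hnt : Nontrivial (S : Set ι) := by
          have : 1 < S.card := by omega
          obtain ⟨a, ha, b, hb, hab⟩ := Finset.one_lt_card.1 this
          exact ⟨⟨a, ha⟩, ⟨b, hb⟩, fun h => hab (congrArg Subtype.val h)⟩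
        obtain ⟨v, hv⟩ := hc.exists_connected_induce_compl_singleton_of_finite_nontrivial
        have hvS : (v : ι) ∈ S := v.2
        have hc' : (T.induce ((S.erase v : Finset ι) : Set ι)).Connected := by
          let e : (T.induce (S : Set ι)).induce ({v}ᶜ : Set (S : Set ι)) ≃g
              T.induce ((S.erase v : Finset ι) : Set ι) :=
            { toFun := fun x => ⟨x.1.1, by
                have h1 : x.1 ≠ v := x.2
                have h2 : x.1.1 ∈ S := x.1.2
                simpa [h2] using fun h => h1 (Subtype.ext h)⟩
              invFun := fun x => ⟨⟨x.1, Finset.mem_of_mem_erase x.2⟩, by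
                have h1 : x.1 ≠ v := Finset.ne_of_mem_erase x.2
                simpa using fun h => h1 (congrArg Subtype.val h)⟩
              left_inv := fun x => rfl
              right_inv := fun x => rfl
              map_rel_iff' := Iff.rfl }
          exact e.connected_iff.1 hv
        obtain ⟨j, hj⟩ : ∃ j, (T.induce (S : Set ι)).Adj v j := by
          obtain ⟨w, hw⟩ := exists_ne v
          obtain ⟨p⟩ := hc.preconnected v w
          cases p with
          | nil => exact absurd rfl hw
          | cons h _ => exact ⟨_, h⟩
        have hjv : T.Adj (v : ι) (j : ι) := hj
        have hjS : (j : ι) ∈ S.erase v := Finset.mem_erase.2 ⟨hjv.ne', j.2⟩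
        rw [← Finset.insert_erase hvS]
        refine step _ _ j (Finset.notMem_erase _ _) hjS hjv.symm ?_
          (ih _ (by rw [Finset.card_erase_of_mem hvS, hS]; rfl) hc')
        intro i hi
        obtain ⟨p, hp⟩ := hc'.preconnected.exists_isPath ⟨i, hi⟩ ⟨j, hjS⟩
        let q : T.Walk i j := p.map (SimpleGraph.Embedding.induce _).toHom
        have hq : q.IsPath :=
          SimpleGraph.Walk.IsPath.map (f := (SimpleGraph.Embedding.induce (G := T) _).toHom)
            Subtype.val_injective hp
        have hqs : (v : ι) ∉ q.support := by
          intro h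
          have h' : (v : ι) ∈ (p.map (SimpleGraph.Embedding.induce (G := T) _).toHom).support := h
          rw [SimpleGraph.Walk.support_map, List.mem_map] at h'
          obtain ⟨y, _, hy⟩ := h'
          have : (y : ι) ∈ S.erase v := y.2
          exact (Finset.ne_of_mem_erase this) hy
        exact hpath i v j (q.concat hjv.symm) (hq.concat hqs hjv.symm) (by
          rw [SimpleGraph.Walk.support_concat]; simp)
  refine key _ Finset.univ rfl ?_
  have : (T.induce (Set.univ : Set ι)).Connected :=
    (SimpleGraph.induceUnivIso T).connected_iff.2 hT.connected
  rw [Finset.coe_univ]; exact this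

/-- Sort a pair. -/
def srt {n : ℕ} (a b : Fin n) : Fin n × Fin n := if a < b then (a, b) else (b, a)

/-- Edges of `H` inside `A`. -/
def EA {n : ℕ} (H : SimpleGraph (Fin n)) [DecidableRel H.Adj] (A : Finset (Fin n)) :
    Finset (Fin n × Fin n) := (edgePairs H).filter fun p => p.1 ∈ A ∧ p.2 ∈ A

/-- Transport of edges. -/
def tr {m n : ℕ} (ψ : Fin m → Fin n) (Q : Finset (Fin m × Fin m)) : Finset (Fin n × Fin n) :=
  Q.image fun p => srt (ψ p.1) (ψ p.2)

lemma tr_injOn {m n : ℕ} (ψ : Fin m → Fin n) (hψ : Function.Injective ψ)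
    (Q : Finset (Fin m × Fin m)) (hQ : ∀ p ∈ Q, p.1 < p.2) :
    Set.InjOn (fun p : Fin m × Fin m => srt (ψ p.1) (ψ p.2)) Q := by
  rintro ⟨a, b⟩ hp ⟨c, d⟩ hq h
  have h1 := hQ _ hp
  have h2 := hQ _ hq
  simp only [srt] at h h1 h2
  split_ifs at h <;> simp only [Prod.mk.injEq] at h <;> obtain ⟨ha, hb⟩ := h <;>
    have ha := hψ ha <;> have hb := hψ hb <;> subst ha <;> subst hb
  · rfl
  · exact absurd h1 h2.not_gt
  · exact absurd h1 h2.not_gt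
  · rfl

lemma tr_card {m n : ℕ} (ψ : Fin m → Fin n) (hψ : Function.Injective ψ)
    (Q : Finset (Fin m × Fin m)) (hQ : ∀ p ∈ Q, p.1 < p.2) : (tr ψ Q).card = Q.card :=
  Finset.card_image_of_injOn (tr_injOn ψ hψ Q hQ)

lemma tr_wp {m n : ℕ} (ψ : Fin m → Fin n) (hψ : Function.Injective ψ)
    (Q : Finset (Fin m × Fin m)) (hQ : ∀ p ∈ Q, p.1 < p.2) (f : ℝ → ℝ → ℝ)
    (hsym : ∀ x y, f x y = f y x) (x : Fin n → ℝ) :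
    wp f (tr ψ Q) x = wp f Q (fun i => x (ψ i)) := by
  unfold wp tr
  rw [Finset.prod_image (tr_injOn ψ hψ Q hQ)]
  refine Finset.prod_congr rfl fun p _ => ?_
  unfold srt
  split_ifs
  · rfl
  · exact hsym _ _

lemma EA_lt {n : ℕ} (H : SimpleGraph (Fin n)) [DecidableRel H.Adj] (A : Finset (Fin n)) :
    ∀ p ∈ EA H A, p.1 < p.2 := by
  intro p hp
  simp only [EA, edgePairs, Finset.mem_filter] at hp
  exact hp.1.2.2

lemma EA_univ {n : ℕ} (H : SimpleGraph (Fin n)) [DecidableRel H.Adj] :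
    EA H Finset.univ = edgePairs H := by simp [EA]

lemma tr_EA {m n : ℕ} (G : SimpleGraph (Fin m)) [DecidableRel G.Adj]
    (H : SimpleGraph (Fin n)) [DecidableRel H.Adj] (A : Finset (Fin m)) (B : Finset (Fin n))
    (ψ : Fin m → Fin n) (hAB : ∀ a ∈ A, ψ a ∈ B) (hsurj : ∀ b ∈ B, ∃ a ∈ A, ψ a = b)
    (hadj : ∀ a ∈ A, ∀ b ∈ A, (H.Adj (ψ a) (ψ b) ↔ G.Adj a b)) :
    tr ψ (EA G A) = EA H B := by
  ext ⟨u, v⟩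
  simp only [tr, EA, edgePairs, Finset.mem_image, Finset.mem_filter, Finset.mem_univ, true_and,
    Prod.exists]
  constructor
  · rintro ⟨a, b, ⟨⟨h1, h2⟩, h3, h4⟩, h5⟩
    have h6 := (hadj a h3 b h4).2 h1
    unfold srt at h5
    split_ifs at h5 with h7 <;> simp only [Prod.mk.injEq] at h5 <;> obtain ⟨rfl, rfl⟩ := h5
    · exact ⟨⟨h6, h7⟩, hAB _ h3, hAB _ h4⟩
    · exact ⟨⟨h6.symm, lt_of_le_of_ne (not_lt.1 h7) h6.ne'⟩, hAB _ h4, hAB _ h3⟩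
  · rintro ⟨⟨h1, h2⟩, h3, h4⟩
    obtain ⟨a, ha, rfl⟩ := hsurj u h3
    obtain ⟨b, hb, rfl⟩ := hsurj v h4
    have h5 := (hadj a ha b hb).1 h1
    rcases lt_or_gt_of_ne h5.ne with h | h
    · exact ⟨a, b, ⟨⟨h5, h⟩, ha, hb⟩, by simp [srt, h2]⟩
    · exact ⟨b, a, ⟨⟨h5.symm, h⟩, hb, ha⟩, by simp [srt, h2.not_gt]⟩

/-- Extended-nonnegative version of `wp`. -/
noncomputable def we {n : ℕ} (f : ℝ → ℝ → ℝ) (Q : Finset (Fin n × Fin n)) (x : Fin n → ℝ) : ℝ≥0∞ :=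
  ENNReal.ofReal (wp f Q x)

lemma we_meas {n : ℕ} {f : ℝ → ℝ → ℝ} (hf : Good f) (Q : Finset (Fin n × Fin n)) :
    Measurable (we f Q) := (wp_meas' hf.meas Q).ennreal_ofReal

lemma we_ne_zero {n : ℕ} {f : ℝ → ℝ → ℝ} (hf : Good f) (Q : Finset (Fin n × Fin n)) (x) :
    we f Q x ≠ 0 := by
  simpa [we] using wp_pos hf Q x

lemma wp_dep {n : ℕ} (f : ℝ → ℝ → ℝ) (Q : Finset (Fin n × Fin n)) (A : Finset (Fin n))
    (h : ∀ p ∈ Q, p.1 ∈ A ∧ p.2 ∈ A) : DependsOn (wp f Q) (A : Set (Fin n)) := by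
  intro x y hxy
  refine Finset.prod_congr rfl fun p hp => ?_
  rw [hxy _ (h p hp).1, hxy _ (h p hp).2]

lemma we_dep {n : ℕ} (f : ℝ → ℝ → ℝ) (Q : Finset (Fin n × Fin n)) (A : Finset (Fin n))
    (h : ∀ p ∈ Q, p.1 ∈ A ∧ p.2 ∈ A) : DependsOn (we f Q) (A : Set (Fin n)) := by
  intro x y hxy
  unfold we
  rw [wp_dep f Q A h hxy]

lemma EA_sub {n : ℕ} (H : SimpleGraph (Fin n)) [DecidableRel H.Adj] (A : Finset (Fin n)) :
    ∀ p ∈ EA H A, p.1 ∈ A ∧ p.2 ∈ A := fun _ hp => (Finset.mem_filter.1 hp).2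

lemma lint_we {n : ℕ} {f : ℝ → ℝ → ℝ} (hf : Good f) (Q : Finset (Fin n × Fin n)) :
    ∫⁻ x, we f Q x ∂Measure.pi (fun _ => um) = ENNReal.ofReal (td f Q) := by
  unfold td we
  rw [ofReal_integral_eq_lintegral_ofReal
    (wp_int hf.meas 1 (fun _ _ => (hf.pos _ _).le) hf.high Q)
    (Filter.Eventually.of_forall fun x => (wp_pos hf Q x).le)]

lemma td_tr {m n : ℕ} (ψ : Fin m → Fin n) (hψ : Function.Injective ψ)
    (Q : Finset (Fin m × Fin m)) (hQ : ∀ p ∈ Q, p.1 < p.2) {f : ℝ → ℝ → ℝ} (hf : Good f)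
    (hsym : ∀ x y, f x y = f y x) : td f (tr ψ Q) = td f Q := by
  have h1 := lint_we hf (tr ψ Q)
  have h2 := lint_we hf Q
  rw [← lint_comp_inj ψ hψ (we f Q) (we_meas hf Q)] at h2
  simp only [we, tr_wp ψ hψ Q hQ f hsym] at h1 h2
  rw [h1] at h2
  exact (ENNReal.ofReal_eq_ofReal_iff (td_pos hf _).le (td_pos hf _).le).1 h2

lemma lm_we_pos {n : ℕ} {f : ℝ → ℝ → ℝ} (hf : Good f) (s : Finset (Fin n))
    (Q : Finset (Fin n × Fin n)) (x) : lm s (we f Q) x ≠ 0 := by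
  obtain ⟨ε, h0, h⟩ := hf.low
  have h1 : ENNReal.ofReal (ε ^ Q.card) ≤ lm s (we f Q) x := by
    have h2 : lm s (fun _ => ENNReal.ofReal (ε ^ Q.card)) x ≤ lm s (we f Q) x := by
      refine lmarginal_mono (fun y => ENNReal.ofReal_le_ofReal ?_) x
      simp only [wp, ← Finset.prod_const]
      exact Finset.prod_le_prod (fun _ _ => h0.le) (fun _ _ => h _ _)
    simpa [lm, lmarginal] using h2
  have : 0 < ENNReal.ofReal (ε ^ Q.card) := ENNReal.ofReal_pos.2 (by positivity)
  exact (this.trans_le h1).ne'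

lemma lm_we_top {n : ℕ} {f : ℝ → ℝ → ℝ} (hf : Good f) (s : Finset (Fin n))
    (Q : Finset (Fin n × Fin n)) (x) : lm s (we f Q) x ≠ ⊤ := by
  have h2 : lm s (we f Q) x ≤ lm s (fun _ => 1) x := by
    refine lmarginal_mono (fun y => ?_) x
    exact ENNReal.ofReal_le_one.2 (wp_le hf Q y)
  have h3 : lm s (fun _ => 1) x = 1 := by simp [lm, lmarginal]
  rw [h3] at h2
  exact (h2.trans_lt ENNReal.one_lt_top).ne

lemma compat_lm {n : ℕ} (H : SimpleGraph (Fin n)) [DecidableRel H.Adj] (A B : Finset (Fin n))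
    (e : (H.induce (A : Set (Fin n))) ≃g (H.induce (B : Set (Fin n))))
    (he : ∀ (v : Fin n) (hvi : v ∈ A) (_ : v ∈ B),
          ((e ⟨v, Finset.mem_coe.mpr hvi⟩ : (B : Set (Fin n))) : Fin n) = v)
    {f : ℝ → ℝ → ℝ} (hf : Good f) (hsym : ∀ x y, f x y = f y x) :
    lm (A ∩ B)ᶜ (we f (EA H B)) = lm (A ∩ B)ᶜ (we f (EA H A)) := by
  classical
  let e0 : {x // x ∈ A} ≃ {x // x ∈ B} := e.toEquiv
  let σ : Equiv.Perm (Fin n) := e0.extendSubtype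
  have hσ : ∀ a (ha : a ∈ A), σ a = e ⟨a, ha⟩ := fun a ha => e0.extendSubtype_apply_of_mem a ha
  have hfix : ∀ a ∈ A ∩ B, σ a = a := by
    intro a ha
    rw [Finset.mem_inter] at ha
    rw [hσ a ha.1]; exact he a ha.1 ha.2
  have htr : tr σ (EA H A) = EA H B := by
    apply tr_EA
    · intro a ha; rw [hσ a ha]; exact (e ⟨a, ha⟩).2
    · intro b hb
      refine ⟨e.symm ⟨b, hb⟩, (e.symm ⟨b, hb⟩).2, ?_⟩
      rw [hσ _ (e.symm ⟨b, hb⟩).2]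
      simp
    · intro a ha b hb
      rw [hσ a ha, hσ b hb]
      exact e.map_rel_iff (a := ⟨a, ha⟩) (b := ⟨b, hb⟩)
  have himg : (A ∩ B)ᶜ.image σ = (A ∩ B)ᶜ := by
    apply Finset.eq_of_subset_of_card_le
    · intro y hy
      obtain ⟨x, hx, rfl⟩ := Finset.mem_image.1 hy
      rw [Finset.mem_compl] at hx ⊢
      intro h
      exact hx (σ.injective (hfix _ h) ▸ h)
    · rw [Finset.card_image_of_injective _ σ.injective]
  funext x
  have h1 := lmarginal_image (μ := fun _ : Fin n => um) σ.injective (A ∩ B)ᶜ (we_meas hf (EA H A)) x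
  rw [himg] at h1
  have h2 : (we f (EA H A) ∘ fun x : Fin n → ℝ => fun i => x (σ i)) = we f (EA H B) := by
    funext y
    simp only [we, Function.comp, ← htr, tr_wp σ σ.injective _ (EA_lt H A) f hsym]
  have h3 : lm (A ∩ B)ᶜ (we f (EA H B)) x = lm (A ∩ B)ᶜ (we f (EA H A)) (fun i => x (σ i)) := by
    rw [← h2]; exact h1
  rw [h3]
  refine lm_dep _ (A ∩ B) _ (by simp) fun i hi => ?_
  dsimp only
  rw [hfix i hi]

lemma bag_tr {n m : ℕ} (H : SimpleGraph (Fin n)) [DecidableRel H.Adj]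
    (N : SimpleGraph (Fin m)) [DecidableRel N.Adj] (A : Finset (Fin n))
    (e : (H.induce (A : Set (Fin n))) ≃g N) :
    ∃ ψ : Fin m → Fin n, Function.Injective ψ ∧ tr ψ (edgePairs N) = EA H A := by
  refine ⟨fun i => (e.symm i).1, fun a b h => e.symm.injective (Subtype.ext h), ?_⟩
  rw [← EA_univ N]
  apply tr_EA
  · intro a _; exact (e.symm a).2
  · intro b hb; exact ⟨e ⟨b, hb⟩, Finset.mem_univ _, by simp⟩
  · intro a _ b _
    exact e.symm.map_rel_iff (a := a) (b := b)


/-- Edges covered by the bags in `S`. -/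
def ES {ι : Type*} {n : ℕ} (H : SimpleGraph (Fin n)) [DecidableRel H.Adj]
    (F : ι → Finset (Fin n)) (S : Finset ι) : Finset (Fin n × Fin n) :=
  S.biUnion fun i => EA H (F i)

/-- Inductive invariant. -/
def Inv {ι : Type*} {n : ℕ} (H : SimpleGraph (Fin n)) [DecidableRel H.Adj]
    (F : ι → Finset (Fin n)) (W : ℝ → ℝ → ℝ) (τ ne : ℝ) (S : Finset ι) : Prop :=
  ∃ (f : (Fin n → ℝ) → ℝ≥0∞) (Φ β : (Fin n → ℝ) → ℝ) (m : ℕ),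
    Measurable f ∧ DependsOn f ((S.biUnion F : Finset (Fin n)) : Set (Fin n)) ∧
    (∀ i ∈ S, lm (F i)ᶜ f = we W (EA H (F i))) ∧
    Measurable β ∧ DependsOn β ((S.biUnion F : Finset (Fin n)) : Set (Fin n)) ∧
    (∀ x, 0 ≤ β x) ∧ (∀ x, 0 < Φ x) ∧ (∀ x, m - β x ≤ Real.log (Φ x)) ∧
    ∫⁻ x, f x * ENNReal.ofReal (β x) ∂Measure.pi (fun _ => um) ≤ m * ENNReal.ofReal τ ∧
    ∀ x, we W (ES H F S) x =
      ENNReal.ofReal (τ ^ (((ES H F S).card : ℝ) / ne - 1)) * f x * ENNReal.ofReal (Φ x)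

lemma inv_base {ι : Type*} [DecidableEq ι] {n : ℕ} (H : SimpleGraph (Fin n)) [DecidableRel H.Adj]
    (F : ι → Finset (Fin n)) {W : ℝ → ℝ → ℝ} (hW : Good W) (τ : ℝ) (k : ℕ) (hk : k ≠ 0) (r : ι)
    (hr : (EA H (F r)).card = k) : Inv H F W τ k {r} := by
  have hES : ES H F {r} = EA H (F r) := by simp [ES]
  have hk' : (k : ℝ) ≠ 0 := Nat.cast_ne_zero.2 hk
  refine ⟨we W (EA H (F r)), fun _ => 1, fun _ => 0, 0, we_meas hW _, ?_, ?_, measurable_const,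
    fun _ _ _ => rfl, by simp, by simp, by simp, by simp, ?_⟩
  · rw [Finset.singleton_biUnion]
    exact we_dep _ _ _ (EA_sub _ _)
  · intro i hi
    rw [Finset.mem_singleton] at hi
    subst hi
    exact lm_id _ (F i) _ (we_dep _ _ _ (EA_sub _ _)) disjoint_compl_left
  · intro x
    rw [hES, hr, div_self hk']
    simp

lemma ennreal_alg (X k Wl A f P C G : ℝ≥0∞) (hk : k ≠ 0) (hk' : k ≠ ⊤) (hC : C ≠ 0) (hC' : C ≠ ⊤)
    (hG : G ≠ 0) (hG' : G ≠ ⊤) (h : X * k = Wl * (A * f * P)) :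
    X = A * C * (f * Wl / G) * (P / (C * k / G)) := by
  have h1 : X = Wl * (A * f * P) / k := by
    rw [← h, ENNReal.mul_div_cancel_right hk hk']
  have h2 : (C * k / G)⁻¹ = C⁻¹ * k⁻¹ * G := by
    rw [div_eq_mul_inv, ENNReal.mul_inv (Or.inr (ENNReal.inv_ne_top.2 hG))
      (Or.inr (ENNReal.inv_ne_zero.2 hG')), inv_inv, ENNReal.mul_inv (Or.inl hC) (Or.inl hC')]
  rw [h1, div_eq_mul_inv P, h2, div_eq_mul_inv, div_eq_mul_inv]
  calc Wl * (A * f * P) * k⁻¹ = Wl * (A * f * P) * k⁻¹ * (C * C⁻¹) * (G⁻¹ * G) := by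
        rw [ENNReal.mul_inv_cancel hC hC', ENNReal.inv_mul_cancel hG hG']; simp
    _ = _ := by ring

lemma inv_step {ι : Type*} [DecidableEq ι] {n : ℕ} (H : SimpleGraph (Fin n)) [DecidableRel H.Adj]
    (F : ι → Finset (Fin n)) {W : ℝ → ℝ → ℝ} (hW : Good W) (τ : ℝ) (hτ : 0 < τ)
    (k : ℕ) (hk : k ≠ 0) (S : Finset ι) (l j : ι) (hj : j ∈ S)
    (hl : (EA H (F l)).card = k)
    (hrun : ∀ i ∈ S, F i ∩ F l ⊆ F j)
    (hG : lm (F j ∩ F l)ᶜ (we W (EA H (F l))) = lm (F j ∩ F l)ᶜ (we W (EA H (F j))))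
    (hdom : td W (EA H (F j ∩ F l)) ≤ τ ^ (((EA H (F j ∩ F l)).card : ℝ) / k))
    (hS : Inv H F W τ k S) : Inv H F W τ k (insert l S) := by
  obtain ⟨f, Φ, β, m, hfm, hfd, hmarg, hβm, hβd, hβ0, hΦ, hlog, hbound, hprod⟩ := hS
  have hk' : (k : ℝ) ≠ 0 := Nat.cast_ne_zero.2 hk
  set K := F j ∩ F l with hK
  set U := S.biUnion F with hU
  set wl := we W (EA H (F l)) with hwl
  set G := lm Kᶜ wl with hGdef
  set c : ℝ := τ ^ (1 - ((EA H K).card : ℝ) / k) with hc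
  have hc0 : 0 < c := Real.rpow_pos_of_pos hτ _
  have hlm : Measurable wl := we_meas hW _
  have hld : DependsOn wl (F l : Set (Fin n)) := we_dep _ _ _ (EA_sub _ _)
  have hG0 : ∀ x, G x ≠ 0 := lm_we_pos hW _ _
  have hGt : ∀ x, G x ≠ ⊤ := lm_we_top hW _ _
  have hGm : Measurable G := lm_meas _ hlm
  have hGd : DependsOn G (K : Set (Fin n)) := lm_dep _ _ _ (by simp)
  have hjU : F j ⊆ U := Finset.subset_biUnion_of_mem F hj
  have hKl : K ⊆ F l := Finset.inter_subset_right
  have hKj : K ⊆ F j := Finset.inter_subset_left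
  have hKU : K ⊆ U := hKj.trans hjU
  have hlU : F l ∩ U ⊆ K := by
    intro v hv
    rw [Finset.mem_inter, hU, Finset.mem_biUnion] at hv
    obtain ⟨h1, i, hi, h2⟩ := hv
    exact Finset.mem_inter.2 ⟨hrun i hi (Finset.mem_inter.2 ⟨h2, h1⟩), h1⟩
  obtain ⟨g1, g2⟩ := glue U (F l) K (F j) f wl (we W (EA H (F j))) G hfm hlm (we_meas hW _) hfd hld
    hlU hKl hKj hjU (hmarg j hj) rfl hG.symm hG0 hGt
  set f' : (Fin n → ℝ) → ℝ≥0∞ := fun x => f x * wl x / G x with hf'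
  have hfm' : Measurable f' := (hfm.mul hlm).div hGm
  have hU' : (insert l S).biUnion F = F l ∪ U := Finset.biUnion_insert
  let r : (Fin n → ℝ) → ℝ := fun x => c * wp W (EA H K) x / (G x).toReal
  have hr0 : ∀ x, 0 < r x := fun x =>
    div_pos (mul_pos hc0 (wp_pos hW _ _)) (ENNReal.toReal_pos (hG0 x) (hGt x))
  have hrE : ∀ x, ENNReal.ofReal (r x) = ENNReal.ofReal c * we W (EA H K) x / G x := by
    intro x
    rw [ENNReal.ofReal_div_of_pos (ENNReal.toReal_pos (hG0 x) (hGt x)), ENNReal.ofReal_mul hc0.le,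
      ENNReal.ofReal_toReal (hGt x)]
    rfl
  have hrm : Measurable r :=
    ((wp_meas' hW.meas _).const_mul c).div hGm.ennreal_toReal
  have hrd : DependsOn r (K : Set (Fin n)) := by
    intro x y hxy
    simp only [r]
    rw [wp_dep W _ K (EA_sub _ _) hxy, hGd hxy]
  have hES : ES H F (insert l S) = EA H (F l) ∪ ES H F S := Finset.biUnion_insert
  have hEI : EA H (F l) ∩ ES H F S = EA H K := by
    ext p
    simp only [ES, EA, Finset.mem_inter, Finset.mem_biUnion, Finset.mem_filter, hK]
    constructor
    · rintro ⟨⟨h1, h2, h3⟩, i, hi, _, h4, h5⟩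
      exact ⟨h1, ⟨hrun i hi (Finset.mem_inter.2 ⟨h4, h2⟩), h2⟩,
        ⟨hrun i hi (Finset.mem_inter.2 ⟨h5, h3⟩), h3⟩⟩
    · rintro ⟨h1, ⟨h2, h3⟩, h4, h5⟩
      exact ⟨⟨h1, h3, h5⟩, j, hj, h1, h2, h4⟩
  refine ⟨f', fun x => Φ x / r x, fun x => β x + r x, m + 1, hfm', ?_, ?_, hβm.add hrm, ?_, ?_, ?_,
    ?_, ?_, ?_⟩
  · rw [hU']
    intro x y hxy
    simp only [hf']
    rw [hfd fun i hi => hxy i (Finset.mem_coe.2 (Finset.mem_union_right _ hi)),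
      hld fun i hi => hxy i (Finset.mem_coe.2 (Finset.mem_union_left _ hi)),
      hGd fun i hi => hxy i (Finset.mem_coe.2 (Finset.mem_union_left _ (hKl hi)))]
  · intro i hi
    rcases Finset.mem_insert.1 hi with rfl | hi
    · exact g2
    · have hiU : F i ⊆ U := Finset.subset_biUnion_of_mem F hi
      have e1 : lm Uᶜ f' = f := by
        have := g1 (fun _ => 1) measurable_const (fun _ _ _ => rfl)
        simpa using this
      rw [← hmarg i hi, lm_nest Uᶜ (F i)ᶜ f' hfm' (Finset.compl_subset_compl.2 hiU), e1,
        lm_nest Uᶜ (F i)ᶜ f hfm (Finset.compl_subset_compl.2 hiU),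
        lm_id Uᶜ U f hfd disjoint_compl_left]
  · rw [hU']
    intro x y hxy
    dsimp only
    rw [hβd fun i hi => hxy i (Finset.mem_coe.2 (Finset.mem_union_right _ hi)),
      hrd fun i hi => hxy i (Finset.mem_coe.2 (Finset.mem_union_left _ (hKl hi)))]
  · intro x; exact add_nonneg (hβ0 x) (hr0 x).le
  · intro x; exact div_pos (hΦ x) (hr0 x)
  · intro x
    rw [Real.log_div (hΦ x).ne' (hr0 x).ne']
    have := Real.log_le_sub_one_of_pos (hr0 x)
    have := hlog x
    push_cast
    linarith
  · have e1 : ∀ x, f' x * ENNReal.ofReal (β x + r x)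
        = f' x * ENNReal.ofReal (β x) + f' x * ENNReal.ofReal (r x) := by
      intro x
      rw [ENNReal.ofReal_add (hβ0 x) (hr0 x).le, mul_add]
    simp only [e1]
    have hmb : Measurable (fun x => f' x * ENNReal.ofReal (β x)) := hfm'.mul hβm.ennreal_ofReal
    have hmr : Measurable (fun x => f' x * ENNReal.ofReal (r x)) := hfm'.mul hrm.ennreal_ofReal
    have hmw : Measurable (fun x => wl x * ENNReal.ofReal (r x)) := hlm.mul hrm.ennreal_ofReal
    rw [lintegral_add_left hmb]
    have e2 : ∫⁻ x, f' x * ENNReal.ofReal (β x) ∂Measure.pi (fun _ => um) ≤ m * ENNReal.ofReal τ := by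
      rw [← lint_lm Uᶜ _ hmb]
      have := g1 (fun x => ENNReal.ofReal (β x)) hβm.ennreal_ofReal
        (fun x y hxy => by dsimp only; rw [hβd hxy])
      rw [this]
      exact hbound
    have hrd' : DependsOn (fun x => ENNReal.ofReal (r x)) (K : Set (Fin n)) :=
      fun x y hxy => by dsimp only; rw [hrd hxy]
    have e3 : ∫⁻ x, f' x * ENNReal.ofReal (r x) ∂Measure.pi (fun _ => um) ≤ ENNReal.ofReal τ := by
      rw [← lint_lm (F l)ᶜ _ hmr,
        lm_pull (F l)ᶜ (F l) f' (fun x => ENNReal.ofReal (r x)) hfm'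
          (hrd'.mono (Finset.coe_subset.2 hKl)) disjoint_compl_left, g2,
        ← lint_lm Kᶜ _ hmw,
        lm_pull Kᶜ K wl (fun x => ENNReal.ofReal (r x)) hlm hrd' disjoint_compl_left]
      have e4 : ∀ x, lm Kᶜ wl x * ENNReal.ofReal (r x) = ENNReal.ofReal c * we W (EA H K) x := by
        intro x
        rw [hrE]
        exact ENNReal.mul_div_cancel (hG0 x) (hGt x)
      simp only [e4]
      rw [lintegral_const_mul _ (we_meas hW _), lint_we hW, ← ENNReal.ofReal_mul hc0.le]
      apply ENNReal.ofReal_le_ofReal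
      calc c * td W (EA H K) ≤ c * τ ^ (((EA H K).card : ℝ) / k) :=
            mul_le_mul_of_nonneg_left hdom hc0.le
        _ = τ := by
            rw [hc, ← Real.rpow_add hτ]; simp
    calc _ ≤ (m : ℝ≥0∞) * ENNReal.ofReal τ + ENNReal.ofReal τ := add_le_add e2 e3
      _ = _ := by push_cast; ring
  · intro x
    have hcard : (((ES H F (insert l S)).card : ℝ)) + (EA H K).card = k + (ES H F S).card := by
      have := Finset.card_union_add_card_inter (EA H (F l)) (ES H F S)
      rw [hEI, ← hES, hl] at this
      exact_mod_cast this
    have hA : ENNReal.ofReal (τ ^ (((ES H F (insert l S)).card : ℝ) / k - 1)) =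
        ENNReal.ofReal (τ ^ (((ES H F S).card : ℝ) / k - 1)) * ENNReal.ofReal c := by
      rw [← ENNReal.ofReal_mul (Real.rpow_nonneg hτ.le _), hc, ← Real.rpow_add hτ]
      congr 2
      have : ((ES H F (insert l S)).card : ℝ) = k + (ES H F S).card - (EA H K).card := by linarith
      rw [this]
      field_simp
      ring
    rw [hA, ENNReal.ofReal_div_of_pos (hr0 x), hrE]
    refine ennreal_alg _ _ _ _ _ _ _ _ (we_ne_zero hW _ _) ENNReal.ofReal_ne_top
      (ENNReal.ofReal_pos.2 hc0).ne' ENNReal.ofReal_ne_top (hG0 x) (hGt x) ?_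
    rw [← hprod x]
    have hp : wp W (ES H F (insert l S)) x * wp W (EA H K) x
        = wp W (EA H (F l)) x * wp W (ES H F S) x := by
      rw [hES, ← hEI]; exact Finset.prod_union_inter
    simp only [hwl, we]
    rw [← ENNReal.ofReal_mul (wp_pos hW _ _).le, hp, ENNReal.ofReal_mul (wp_pos hW _ _).le]

lemma inv_final {ι : Type*} {n : ℕ} (H : SimpleGraph (Fin n)) [DecidableRel H.Adj]
    (F : ι → Finset (Fin n)) {W : ℝ → ℝ → ℝ} (hW : Good W) (τ : ℝ) (hτ : 0 < τ) (k : ℝ)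
    (S : Finset ι) (i : ι) (hi : i ∈ S) (hiτ : td W (EA H (F i)) = τ)
    (hS : Inv H F W τ k S) : τ ^ (((ES H F S).card : ℝ) / k) ≤ td W (ES H F S) := by
  obtain ⟨f, Φ, β, m, hfm, hfd, hmarg, hβm, hβd, hβ0, hΦ, hlog, hbound, hprod⟩ := hS
  have h1 : ∫⁻ x, f x ∂Measure.pi (fun _ => um) = ENNReal.ofReal τ := by
    rw [← lint_lm (F i)ᶜ _ hfm, hmarg i hi, lint_we hW, hiτ]
  have h2 : ∀ x, f x * (1 + m) ≤ f x * ENNReal.ofReal (β x) + f x * ENNReal.ofReal (Φ x) := by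
    intro x
    rw [← mul_add, ← ENNReal.ofReal_add (hβ0 x) (hΦ x).le]
    gcongr
    have : (1 : ℝ≥0∞) + m = ENNReal.ofReal (1 + m) := by
      rw [ENNReal.ofReal_add zero_le_one (Nat.cast_nonneg m)]; simp
    rw [this]
    apply ENNReal.ofReal_le_ofReal
    have := Real.log_le_sub_one_of_pos (hΦ x)
    have := hlog x
    linarith
  have h3 := lintegral_mono (μ := Measure.pi (fun _ : Fin n => um)) h2
  have hmb : Measurable (fun x => f x * ENNReal.ofReal (β x)) := hfm.mul hβm.ennreal_ofReal
  rw [lintegral_add_left hmb, lintegral_mul_const _ hfm, h1] at h3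
  have h4 : ENNReal.ofReal τ ≤ ∫⁻ x, f x * ENNReal.ofReal (Φ x) ∂Measure.pi (fun _ => um) := by
    have h5 := h3.trans (add_le_add_left hbound _)
    have h6 : ENNReal.ofReal τ * (1 + m) = m * ENNReal.ofReal τ + ENNReal.ofReal τ := by ring
    rw [h6] at h5
    exact (ENNReal.add_le_add_iff_left (ENNReal.mul_ne_top (ENNReal.natCast_ne_top m)
      ENNReal.ofReal_ne_top)).1 h5
  have h7 := lint_we hW (ES H F S)
  simp only [hprod, mul_assoc] at h7
  rw [lintegral_const_mul' _ _ ENNReal.ofReal_ne_top] at h7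
  have h8 : ENNReal.ofReal (τ ^ (((ES H F S).card : ℝ) / k)) ≤ ENNReal.ofReal (td W (ES H F S)) := by
    rw [← h7]
    refine le_trans ?_ (mul_le_mul_right h4 _)
    rw [← ENNReal.ofReal_mul (Real.rpow_nonneg hτ.le _)]
    apply ENNReal.ofReal_le_ofReal
    nth_rw 3 [← Real.rpow_one τ]
    rw [← Real.rpow_add hτ]; simp
  exact (ENNReal.ofReal_le_ofReal_iff (td_pos hW _).le).1 h8

lemma td_single {n : ℕ} (a b : Fin n) (hab : a < b) {W : ℝ → ℝ → ℝ} (hW : Good W)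
    (hsym : ∀ x y, W x y = W y x) :
    td W {(a, b)} = ∫ z in Set.Icc (0 : ℝ) 1 ×ˢ Set.Icc (0 : ℝ) 1, W z.1 z.2 := by
  have h1 : tr ![a, b] {((0 : Fin 2), (1 : Fin 2))} = {(a, b)} := by
    simp [tr, srt, hab]
  rw [← h1, td_tr _ _ _ (by simp) hW hsym]
  · have h2 := (measurePreserving_finTwoArrow um).integral_comp'
      (fun z : ℝ × ℝ => W z.1 z.2)
    have h3 : (volume : Measure (ℝ × ℝ)).restrict (Set.Icc (0 : ℝ) 1 ×ˢ Set.Icc (0 : ℝ) 1)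
        = um.prod um := by
      rw [um, Measure.prod_restrict]; rfl
    rw [h3, ← h2]
    unfold td wp
    simp
  · intro i j h
    fin_cases i <;> fin_cases j <;> simp_all [hab.ne, hab.ne']

lemma main_good {nV nN : ℕ} {ι : Type*} [Fintype ι]
    (N : SimpleGraph (Fin nN)) [DecidableRel N.Adj]
    (H : SimpleGraph (Fin nV)) [DecidableRel H.Adj]
    (hWN : WeaklyNorming N) (hNE : (edgePairs N).Nonempty)
    (T : SimpleGraph ι) (hT : T.IsTree)
    (F : ι → Finset (Fin nV))
    (hedge : ∀ u v : Fin nV, H.Adj u v → ∃ i, u ∈ F i ∧ v ∈ F i)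
    (hpath : ∀ (i j kk : ι) (p : T.Walk i j), p.IsPath → kk ∈ p.support →
      F i ∩ F j ⊆ F kk)
    (hbag : ∀ i, Nonempty ((H.induce (↑(F i) : Set (Fin nV))) ≃g N))
    (hcompat : ∀ i j, T.Adj i j →
      ∃ e : (H.induce (↑(F i) : Set (Fin nV))) ≃g (H.induce (↑(F j) : Set (Fin nV))),
        ∀ (v : Fin nV) (hvi : v ∈ F i) (_ : v ∈ F j),
          ((e ⟨v, Finset.mem_coe.mpr hvi⟩ : (↑(F j) : Set (Fin nV))) : Fin nV) = v)
    (W : ℝ → ℝ → ℝ) (hsym : ∀ x y, W x y = W y x) (hW : Good W) :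
    tDen N W ^ (((edgePairs H).card : ℝ) / ((edgePairs N).card : ℝ)) ≤ tDen H W ∧
    (∫ z in Set.Icc (0 : ℝ) 1 ×ˢ Set.Icc (0 : ℝ) 1, W z.1 z.2) ^ (edgePairs H).card ≤
      tDen H W := by
  classical
  have hNlt : ∀ p ∈ edgePairs N, p.1 < p.2 := by rw [← EA_univ N]; exact EA_lt N _
  have hk : (edgePairs N).card ≠ 0 := Finset.card_ne_zero.2 hNE
  set τ := td W (edgePairs N) with hτdef
  have hτ : 0 < τ := td_pos hW _
  have hc : ∀ i, (EA H (F i)).card = (edgePairs N).card ∧ td W (EA H (F i)) = τ ∧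
      ∀ Q ⊆ EA H (F i), td W Q ≤ τ ^ ((Q.card : ℝ) / ((edgePairs N).card : ℝ)) := by
    intro i
    obtain ⟨e⟩ := hbag i
    obtain ⟨ψ, hψ, htr⟩ := bag_tr H N (F i) e
    refine ⟨by rw [← htr, tr_card ψ hψ _ hNlt], by rw [← htr, td_tr ψ hψ _ hNlt hW hsym], ?_⟩
    intro Q hQ
    rw [← htr] at hQ
    obtain ⟨J, hJ, rfl⟩ := Finset.subset_image_iff.1 hQ
    have hJ' : J ⊆ edgePairs N := by exact_mod_cast hJ
    have hJlt : ∀ p ∈ J, p.1 < p.2 := fun p hp => hNlt p (hJ' hp)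
    change td W (tr ψ J) ≤ τ ^ (((tr ψ J).card : ℝ) / _)
    rw [tr_card ψ hψ _ hJlt, td_tr ψ hψ _ hJlt hW hsym]
    exact dom N hWN hNE hW J hJ'
  have hInv : Inv H F W τ ((edgePairs N).card : ℝ) Finset.univ := by
    refine tree_ind T hT F hpath _ (fun r => ?_) ?_
    · exact inv_base H F hW τ _ hk r (hc r).1
    · intro S l j _ hj hadj hrun ih
      obtain ⟨e, he⟩ := hcompat j l hadj
      refine inv_step H F hW τ hτ _ hk S l j hj (hc l).1 hrun
        (compat_lm H (F j) (F l) e he hW hsym) ((hc l).2.2 _ ?_) ih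
      intro p hp
      simp only [EA, Finset.mem_filter, Finset.mem_inter] at hp ⊢
      exact ⟨hp.1, hp.2.1.2, hp.2.2.2⟩
  obtain ⟨i⟩ := hT.connected.nonempty
  have h1 := inv_final H F hW τ hτ _ Finset.univ i (Finset.mem_univ _) (hc i).2.1 hInv
  have hES : ES H F Finset.univ = edgePairs H := by
    ext p
    simp only [ES, EA, Finset.mem_biUnion, Finset.mem_filter, Finset.mem_univ, true_and]
    constructor
    · rintro ⟨i, h, _⟩; exact h
    · intro h
      have h' := h
      simp only [edgePairs, Finset.mem_filter] at h'
      obtain ⟨i, hi⟩ := hedge _ _ h'.2.1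
      exact ⟨i, h, hi⟩
  rw [hES] at h1
  rw [tDen_eq, tDen_eq]
  refine ⟨h1, le_trans ?_ h1⟩
  obtain ⟨⟨a, b⟩, hab⟩ := hNE
  have h2 := dom N hWN ⟨_, hab⟩ hW {(a, b)} (Finset.singleton_subset_iff.2 hab)
  have h0 := (td_pos hW {(a, b)}).le
  rw [← td_single a b (hNlt _ hab) hW hsym]
  refine (pow_le_pow_left₀ h0 h2 _).trans_eq ?_
  rw [← Real.rpow_natCast, ← Real.rpow_mul hτ.le]
  congr 1
  rw [Finset.card_singleton]; push_cast; ring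

lemma td_tendsto {n : ℕ} (Q : Finset (Fin n × Fin n)) (W : ℝ → ℝ → ℝ) (u : ℕ → ℝ → ℝ → ℝ)
    (hm : ∀ k, Measurable (Function.uncurry (u k))) (h0 : ∀ k x y, 0 ≤ u k x y)
    (h1 : ∀ k x y, u k x y ≤ 1)
    (hu : ∀ x y, Filter.Tendsto (fun k => u k x y) Filter.atTop (nhds (W x y))) :
    Filter.Tendsto (fun k => td (u k) Q) Filter.atTop (nhds (td W Q)) := by
  refine tendsto_integral_of_dominated_convergence (fun _ => 1)
    (fun k => (wp_meas' (hm k) Q).aestronglyMeasurable) (integrable_const _)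
    (fun k => Filter.Eventually.of_forall fun x => ?_)
    (Filter.Eventually.of_forall fun x => tendsto_finsetProd _ fun p _ => hu _ _)
  have : 0 ≤ wp (u k) Q x := Finset.prod_nonneg fun _ _ => h0 _ _ _
  rw [Real.norm_of_nonneg this]
  exact Finset.prod_le_one (fun _ _ => h0 _ _ _) fun _ _ => h1 _ _ _

end NDec

open NDec

/-- If `N` is weakly norming and `H` is `N`-decomposable — `H` has a tree decomposition
`(F, T)` whose bags induce copies of `N`, with an isomorphism fixing `X ∩ Y` between the
copies at adjacent bags `X, Y` — then for every graphon `W`,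
`t_H(W) ≥ t_N(W)^{|E(H)|/|E(N)|}`; in particular `H` has Sidorenko's property:
`t_H(W) ≥ t_{K₂}(W)^{|E(H)|}`. -/
theorem ndecomposable_sidorenko {nV nN : ℕ} {ι : Type*} [Fintype ι]
    (N : SimpleGraph (Fin nN)) [DecidableRel N.Adj]
    (H : SimpleGraph (Fin nV)) [DecidableRel H.Adj]
    (hWN : WeaklyNorming N) (hNE : (edgePairs N).Nonempty)
    (T : SimpleGraph ι) (hT : T.IsTree)
    (F : ι → Finset (Fin nV))
    (hcover : ∀ v : Fin nV, ∃ i, v ∈ F i)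
    (hedge : ∀ u v : Fin nV, H.Adj u v → ∃ i, u ∈ F i ∧ v ∈ F i)
    (hpath : ∀ (i j kk : ι) (p : T.Walk i j), p.IsPath → kk ∈ p.support →
      F i ∩ F j ⊆ F kk)
    (hbag : ∀ i, Nonempty ((H.induce (↑(F i) : Set (Fin nV))) ≃g N))
    (hcompat : ∀ i j, T.Adj i j →
      ∃ e : (H.induce (↑(F i) : Set (Fin nV))) ≃g (H.induce (↑(F j) : Set (Fin nV))),
        ∀ (v : Fin nV) (hvi : v ∈ F i) (_ : v ∈ F j),
          ((e ⟨v, Finset.mem_coe.mpr hvi⟩ : (↑(F j) : Set (Fin nV))) : Fin nV) = v)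
    (Wf : ℝ → ℝ → ℝ)
    (hsym : ∀ x y, Wf x y = Wf y x)
    (hmeas : Measurable (Function.uncurry Wf))
    (hrange : ∀ x y, Wf x y ∈ Set.Icc (0 : ℝ) 1) :
    tDen N Wf ^ (((edgePairs H).card : ℝ) / ((edgePairs N).card : ℝ)) ≤ tDen H Wf ∧
    (∫ z in Set.Icc (0 : ℝ) 1 ×ˢ Set.Icc (0 : ℝ) 1, Wf z.1 z.2) ^ (edgePairs H).card ≤
      tDen H Wf := by
  let u : ℕ → ℝ → ℝ → ℝ := fun k x y => Wf x y + (1 / ((k : ℝ) + 1)) * (1 - Wf x y)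
  have hpos : ∀ k : ℕ, 0 < 1 / ((k : ℝ) + 1) := fun k => by positivity
  have hle1 : ∀ k : ℕ, 1 / ((k : ℝ) + 1) ≤ 1 := fun k => by
    rw [div_le_one (by positivity)]; linarith [(Nat.cast_nonneg k : (0 : ℝ) ≤ k)]
  have hg : ∀ k, Good (u k) := by
    intro k
    refine ⟨?_, ⟨1 / ((k : ℝ) + 1), hpos k, ?_⟩, ?_⟩
    · exact hmeas.add ((measurable_const.sub hmeas).const_mul _)
    · intro x y
      obtain ⟨h0, h1⟩ := hrange x y
      simp only [u]
      nlinarith [hle1 k]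
    · intro x y
      obtain ⟨h0, h1⟩ := hrange x y
      simp only [u]
      nlinarith [hle1 k]
  have hlim : ∀ x y, Filter.Tendsto (fun k => u k x y) Filter.atTop (nhds (Wf x y)) := by
    intro x y
    have := (tendsto_one_div_add_atTop_nhds_zero_nat (𝕜 := ℝ)).mul_const (1 - Wf x y)
    simpa [u] using this.const_add (Wf x y)
  have hus : ∀ k x y, u k x y = u k y x := fun k x y => by simp only [u, hsym x y]
  have hm := fun k => main_good N H hWN hNE T hT F hedge hpath hbag hcompat (u k) (hus k) (hg k)
  have h0 : ∀ k x y, 0 ≤ u k x y := fun k x y => ((hg k).pos x y).le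
  have tH := td_tendsto (edgePairs H) Wf u (fun k => (hg k).meas) h0 (fun k => (hg k).high) hlim
  have tN := td_tendsto (edgePairs N) Wf u (fun k => (hg k).meas) h0 (fun k => (hg k).high) hlim
  have tE : Filter.Tendsto
      (fun k => ∫ z in Set.Icc (0 : ℝ) 1 ×ˢ Set.Icc (0 : ℝ) 1, u k z.1 z.2) Filter.atTop
      (nhds (∫ z in Set.Icc (0 : ℝ) 1 ×ˢ Set.Icc (0 : ℝ) 1, Wf z.1 z.2)) := by
    have hfin : IsFiniteMeasure ((volume : Measure (ℝ × ℝ)).restrict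
        (Set.Icc (0 : ℝ) 1 ×ˢ Set.Icc (0 : ℝ) 1)) := by
      refine ⟨?_⟩
      rw [Measure.restrict_apply_univ]
      exact (isCompact_Icc.prod isCompact_Icc).measure_lt_top
    refine tendsto_integral_of_dominated_convergence (fun _ => 1)
      (fun k => (hg k).meas.aestronglyMeasurable) (integrable_const _)
      (fun k => Filter.Eventually.of_forall fun z => ?_)
      (Filter.Eventually.of_forall fun z => hlim _ _)
    rw [Real.norm_of_nonneg (h0 _ _ _)]
    exact (hg k).high _ _
  simp only [tDen_eq] at hm ⊢
  constructor
  · exact le_of_tendsto_of_tendsto' (tN.rpow_const (Or.inr (by positivity))) tH fun k => (hm k).1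
  · exact le_of_tendsto_of_tendsto' (tE.pow _) tH fun k => (hm k).2
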